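/- arXiv:1303.5188 — 5 statements merged into one kernel-verified Lean document; each statement's English description precedes it below -/
import Mathlib

section
/- If p | r, then τ_l(χ_φ) = 0, where χ_φ = (μ∘det)·((1/p)·Ind_{N_{m+1}}^{G_l}(φ|_{N_{m+1}}) − Ind_{L}^{G_l} φ). (Theorem 3.5(1): vanishing of Gauss sums for the degree-p^{l−1}(p−1) characters of G_l, l odd, when p divides r.) -/
noncomputable section
open Matrix Complex

/-- The additive character `x ↦ ζ_N^{r·x} = exp(2πi·r·x/N)` of `ZMod N`. -/
def aChar (N : ℕ) (r : ℤ) (x : ZMod N) : ℂ :=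
  Complex.exp (2 * Real.pi * Complex.I * (r : ℂ) * (x.val : ℂ) / (N : ℂ))

/-- The Gauss sum `τ_l(χ) = Σ_{X ∈ GL₂(ℤ/N)} χ(X) e(Tr X)` with `e = aChar N r`. -/
def tauGL (N : ℕ) [NeZero N] (r : ℤ) (χ : GL (Fin 2) (ZMod N) → ℂ) : ℂ :=
  ∑ X : GL (Fin 2) (ZMod N), χ X * aChar N r (Matrix.trace X.val)

/-- `(Ind_H^T ψ)(g) = |H|⁻¹ Σ_{x ∈ T, x g x⁻¹ ∈ H} ψ(x g x⁻¹)`; induction to the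
full group is the case `T = Set.univ`. -/
def indC (N : ℕ) [NeZero N] (H T : Set (GL (Fin 2) (ZMod N)))
    (ψ : GL (Fin 2) (ZMod N) → ℂ) (g : GL (Fin 2) (ZMod N)) : ℂ :=
  (Nat.card H : ℂ)⁻¹ *
    ∑ x : GL (Fin 2) (ZMod N), T.indicator (fun y => H.indicator ψ (y * g * y⁻¹)) x

/-- The congruence set `K_k = {I + p^k B}` inside `GL₂(ℤ/p^l)`. -/
def Kset (p l k : ℕ) : Set (GL (Fin 2) (ZMod (p ^ l))) :=
  {X | ∃ B : Matrix (Fin 2) (Fin 2) (ZMod (p ^ l)),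
        X.val = 1 + ((p : ZMod (p ^ l)) ^ k) • B}

/-- `S = {[[a, εb],[b, a]]} ∩ GL₂(ℤ/p^l)`. -/
def Sset (p l ε : ℕ) : Set (GL (Fin 2) (ZMod (p ^ l))) :=
  {X | ∃ a b : ZMod (p ^ l), X.val = !![a, (ε : ZMod (p ^ l)) * b; b, a]}

/-- `K_k · S`. -/
def TKS (p l ε k : ℕ) : Set (GL (Fin 2) (ZMod (p ^ l))) :=
  {X | ∃ Y ∈ Kset p l k, ∃ Z ∈ Sset p l ε, X = Y * Z}

/-- `N_{m+1} = {[[a, pεb+p^{m+1}c],[pb, a+p^{m+1}d]]} ∩ GL₂(ℤ/p^l)`. -/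
def NsetOdd (p l ε m : ℕ) : Set (GL (Fin 2) (ZMod (p ^ l))) :=
  {X | ∃ a b c d : ZMod (p ^ l),
    X.val = !![a, (p : ZMod (p ^ l)) * (ε : ZMod (p ^ l)) * b + (p : ZMod (p ^ l)) ^ (m + 1) * c;
               (p : ZMod (p ^ l)) * b, a + (p : ZMod (p ^ l)) ^ (m + 1) * d]}

/-- `φ_A(X) = λ(Tr(A(X−I)))` with `λ = aChar (p^l) 1`. -/
def phiA (p l : ℕ) (A : Matrix (Fin 2) (Fin 2) (ZMod (p ^ l)))
    (X : GL (Fin 2) (ZMod (p ^ l))) : ℂ :=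
  aChar (p ^ l) 1 (Matrix.trace (A * (X.val - 1)))

theorem aChar_eq_stdAddChar (N : ℕ) [NeZero N] (r : ℤ) (x : ZMod N) :
    aChar N r x = ZMod.stdAddChar ((r : ZMod N) * x) := by
  have h : (r : ZMod N) * x = ((r * (x.val : ℤ) : ℤ) : ZMod N) := by simp
  rw [h, ZMod.stdAddChar_coe, aChar]
  push_cast
  congr 1
  ring

/-- If right translation by a determinant-one element `u` preserves `H` and the additive factor,
while it multiplies `ψ` by a constant `c ≠ 1`, then the Gauss sum of the induced function twisted
by `μ ∘ det` vanishes. -/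
theorem sum_det_mul_indC_mul_aChar_eq_zero {N : ℕ} [NeZero N] (r : ℤ) (μ : ZMod N → ℂ)
    (H : Set (GL (Fin 2) (ZMod N))) (ψ : GL (Fin 2) (ZMod N) → ℂ) (u : GL (Fin 2) (ZMod N))
    (hu : u.val.det = 1) {c : ℂ} (hc : c ≠ 1) (hH : ∀ X, X * u ∈ H ↔ X ∈ H)
    (hψ : ∀ X ∈ H, ψ (X * u) = ψ X * c)
    (htr : ∀ X : GL (Fin 2) (ZMod N),
      aChar N r (X * u).val.trace = aChar N r X.val.trace) :
    ∑ X : GL (Fin 2) (ZMod N),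
      μ X.val.det * indC N H Set.univ ψ X * aChar N r X.val.trace = 0 := by
  have hbase : ∑ X : GL (Fin 2) (ZMod N),
      μ X.val.det * H.indicator ψ X * aChar N r X.val.trace = 0 := by
    refine eq_zero_of_mul_eq_self_left hc ?_
    rw [Finset.mul_sum]
    refine Eq.trans (Finset.sum_congr rfl fun X _ => ?_) (Equiv.sum_comp (Equiv.mulRight u) _)
    have hind : H.indicator ψ (X * u) = H.indicator ψ X * c := by
      by_cases hX : X ∈ H
      · rw [Set.indicator_of_mem hX, Set.indicator_of_mem ((hH X).2 hX), hψ X hX]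
      · rw [Set.indicator_of_notMem hX, Set.indicator_of_notMem (mt (hH X).1 hX), zero_mul]
    have hdet : (X * u).val.det = X.val.det := by simp [hu]
    rw [Equiv.coe_mulRight, hind, htr, hdet]
    ring
  simp only [indC, Set.indicator_univ, Finset.mul_sum, Finset.sum_mul]
  rw [Finset.sum_comm]
  refine Finset.sum_eq_zero fun x _ => ?_
  rw [← mul_zero (Nat.card H : ℂ)⁻¹, ← hbase, Finset.mul_sum]
  refine Eq.trans (Finset.sum_congr rfl fun X _ => ?_)
    (Equiv.sum_comp (MulAut.conj x).toEquiv _)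
  have hdet : (x * X * x⁻¹).val.det = X.val.det := by
    rw [Units.val_mul, Units.val_mul, Matrix.det_mul, Matrix.det_mul, mul_right_comm,
      ← Matrix.det_mul, ← Units.val_mul, mul_inv_cancel, Units.val_one, det_one, one_mul]
  have htrace : (x * X * x⁻¹).val.trace = X.val.trace := by
    rw [Units.val_mul, Matrix.trace_mul_comm, ← Units.val_mul]
    simp
  simp only [MulEquiv.toEquiv_eq_coe, EquivLike.coe_coe, MulAut.conj_apply]
  rw [hdet, htrace]
  ring

/-- The upper unipotent matrix `[[1, t], [0, 1]]`. -/
def upperUnipotent {R : Type*} [CommRing R] (t : R) : GL (Fin 2) R where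
  val := !![1, t; 0, 1]
  inv := !![1, -t; 0, 1]
  val_inv := by ext i j; fin_cases i <;> fin_cases j <;> simp
  inv_val := by ext i j; fin_cases i <;> fin_cases j <;> simp

theorem mul_upperUnipotent_mul_neg {R : Type*} [CommRing R] (t : R) (X : GL (Fin 2) R) :
    X * upperUnipotent t * upperUnipotent (-t) = X := by
  have h : (upperUnipotent (-t) : GL (Fin 2) R) = (upperUnipotent t)⁻¹ := Units.ext rfl
  rw [h, mul_inv_cancel_right]

theorem mul_upperUnipotent_mem_iff {R : Type*} [CommRing R] {H : Set (GL (Fin 2) R)} {q : R}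
    (h : ∀ t, ∀ X ∈ H, X * upperUnipotent (q * t) ∈ H) (t : R) (X : GL (Fin 2) R) :
    X * upperUnipotent (q * t) ∈ H ↔ X ∈ H := by
  refine ⟨fun hX => ?_, h t X⟩
  have h' := h (-t) _ hX
  rwa [mul_neg, mul_upperUnipotent_mul_neg] at h'

section Congruence

variable {p l k : ℕ}

theorem upperUnipotent_mem_Kset (t : ZMod (p ^ l)) {j : ℕ} (hkj : k ≤ j) :
    upperUnipotent ((p : ZMod (p ^ l)) ^ j * t) ∈ Kset p l k := by
  obtain ⟨d, rfl⟩ := Nat.exists_eq_add_of_le hkj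
  refine ⟨!![0, (p : ZMod (p ^ l)) ^ d * t; 0, 0], ?_⟩
  ext i j
  fin_cases i <;> fin_cases j <;> simp [upperUnipotent, pow_add, mul_assoc]

theorem Kset_mul_mem {X Y : GL (Fin 2) (ZMod (p ^ l))} (hX : X ∈ Kset p l k)
    (hY : Y ∈ Kset p l k) : X * Y ∈ Kset p l k := by
  obtain ⟨B, hB⟩ := hX
  obtain ⟨C, hC⟩ := hY
  refine ⟨B + X.val * C, ?_⟩
  rw [Units.val_mul, hC, mul_add, mul_one, Matrix.mul_smul, smul_add, ← add_assoc, ← hB]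

theorem Kset_conj_mem {X : GL (Fin 2) (ZMod (p ^ l))} (hX : X ∈ Kset p l k)
    (Z : GL (Fin 2) (ZMod (p ^ l))) : Z * X * Z⁻¹ ∈ Kset p l k := by
  obtain ⟨B, hB⟩ := hX
  refine ⟨Z.val * B * (Z⁻¹).val, ?_⟩
  rw [Units.val_mul, Units.val_mul, hB, mul_add, mul_one, add_mul, ← Units.val_mul,
    mul_inv_cancel, Units.val_one, Matrix.mul_smul, Matrix.smul_mul]

theorem TKS_mul_mem {ε : ℕ} {X Y : GL (Fin 2) (ZMod (p ^ l))} (hX : X ∈ TKS p l ε k)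
    (hY : Y ∈ Kset p l k) : X * Y ∈ TKS p l ε k := by
  obtain ⟨V, hV, Z, hZ, rfl⟩ := hX
  exact ⟨V * (Z * Y * Z⁻¹), Kset_mul_mem hV (Kset_conj_mem hY Z), Z, hZ, by group⟩

theorem Kset_subset_TKS (ε : ℕ) : Kset p l k ⊆ TKS p l ε k := fun Y hY =>
  ⟨Y, hY, 1, ⟨1, 0, by ext i j; fin_cases i <;> fin_cases j <;> simp⟩, (mul_one Y).symm⟩

theorem NsetOdd_subset_TKS (ε m : ℕ) :
    NsetOdd p l ε m ⊆ TKS p l ε (m + 1) := by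
  rintro X ⟨a, b, c, d, hX⟩
  set P : ZMod (p ^ l) := (p : ZMod (p ^ l)) with hP
  have hnil : IsNilpotent P := ⟨l, by rw [hP, ← Nat.cast_pow, ZMod.natCast_self]⟩
  have hdetX : IsUnit X.val.det := (Matrix.isUnit_iff_isUnit_det _).1 X.isUnit
  have hZ : IsUnit (!![a, (ε : ZMod (p ^ l)) * (P * b); P * b, a]).det := by
    have h : (!![a, (ε : ZMod (p ^ l)) * (P * b); P * b, a]).det =
        X.val.det + P * (P ^ m * (P * b * c - a * d)) := by
      rw [hX, Matrix.det_fin_two_of, Matrix.det_fin_two_of]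
      ring
    rw [h]
    exact IsNilpotent.isUnit_add_left_of_commute
      (Commute.isNilpotent_mul_right (Commute.all _ _) hnil) hdetX (Commute.all _ _)
  obtain ⟨Z, hZv⟩ := (Matrix.isUnit_iff_isUnit_det _).2 hZ
  refine ⟨X * Z⁻¹, ⟨!![0, c; 0, d] * (Z⁻¹).val, ?_⟩, Z, ⟨a, P * b, hZv⟩, by group⟩
  have hsplit : X.val = Z.val + P ^ (m + 1) • !![0, c; 0, d] := by
    rw [hX, hZv]
    ext i j
    fin_cases i <;> fin_cases j <;> simp <;> ring
  rw [Units.val_mul, hsplit, add_mul, ← Units.val_mul, mul_inv_cancel, Units.val_one,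
    Matrix.smul_mul]

theorem NsetOdd_mul_upperUnipotent_mem (ε m : ℕ) {j : ℕ} (hmj : m + 1 ≤ j) (t : ZMod (p ^ l))
    {X : GL (Fin 2) (ZMod (p ^ l))} (hX : X ∈ NsetOdd p l ε m) :
    X * upperUnipotent ((p : ZMod (p ^ l)) ^ j * t) ∈ NsetOdd p l ε m := by
  obtain ⟨e, rfl⟩ := Nat.exists_eq_add_of_le hmj
  obtain ⟨a, b, c, d, hX⟩ := hX
  refine ⟨a, b, c + (p : ZMod (p ^ l)) ^ e * t * a,
    d + (p : ZMod (p ^ l)) ^ e * t * ((p : ZMod (p ^ l)) * b), ?_⟩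
  rw [Units.val_mul, hX]
  ext i j
  fin_cases i <;> fin_cases j <;> simp [upperUnipotent, Matrix.mul_apply, Fin.sum_univ_two] <;> ring

end Congruence

/-- Theorem 3.5(1): for `l = 2m+1` odd and
`χ_φ = (μ∘det)·((1/p)·Ind_{N_{m+1}}^{G_l}(φ|_{N_{m+1}}) − Ind_{L}^{G_l} φ)` of degree
`p^{l-1}(p-1)`, if `p ∣ r` then `τ_l(χ_φ) = 0`. -/
theorem gauss_sum_X2_odd_vanishing (p m : ℕ) [Fact p.Prime] (hp : Odd p) (hm : 1 ≤ m)
    (r : ℤ) (hr : ¬ ((p : ℤ) ^ (2 * m + 1) ∣ r)) (hpr : (p : ℤ) ∣ r)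
    (α ε : ℕ) (hα : α < p ^ m) (hε : ε < p ^ m) (hres : ¬ IsSquare (ε : ZMod p))
    (μ : ZMod (p ^ (2 * m + 1)) → ℂ)
    (hμmul : ∀ x y : ZMod (p ^ (2 * m + 1)), IsUnit x → IsUnit y → μ (x * y) = μ x * μ y)
    (hμne : ∀ x : ZMod (p ^ (2 * m + 1)), IsUnit x → μ x ≠ 0)
    (hμ : μ (1 + (p : ZMod (p ^ (2 * m + 1))) ^ (m + 1)) =
      aChar (p ^ (2 * m + 1)) 1
        ((p : ZMod (p ^ (2 * m + 1))) ^ (m + 1) * (α : ZMod (p ^ (2 * m + 1)))))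
    (φ : GL (Fin 2) (ZMod (p ^ (2 * m + 1))) → ℂ)
    (hφmul : ∀ X Y : GL (Fin 2) (ZMod (p ^ (2 * m + 1))),
      X ∈ TKS p (2 * m + 1) ε (m + 1) → Y ∈ TKS p (2 * m + 1) ε (m + 1) →
        φ (X * Y) = φ X * φ Y)
    (hφne : ∀ X ∈ TKS p (2 * m + 1) ε (m + 1), φ X ≠ 0)
    (hφK : ∀ X ∈ Kset p (2 * m + 1) (m + 1),
      φ X = phiA p (2 * m + 1)
        !![(0 : ZMod (p ^ (2 * m + 1))), (ε : ZMod (p ^ (2 * m + 1))); 1, 0] X) :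
    tauGL (p ^ (2 * m + 1)) r (fun X =>
      μ X.val.det *
        ((1 / (p : ℂ)) *
            indC (p ^ (2 * m + 1)) (NsetOdd p (2 * m + 1) ε m) Set.univ φ X -
          indC (p ^ (2 * m + 1)) (TKS p (2 * m + 1) ε (m + 1)) Set.univ φ X)) = 0 := by
  set P : ZMod (p ^ (2 * m + 1)) := (p : ZMod (p ^ (2 * m + 1))) with hP
  have hPl : P ^ (2 * m + 1) = 0 := by rw [hP, ← Nat.cast_pow, ZMod.natCast_self]
  have hPne : P ^ (2 * m) ≠ 0 := by
    rw [hP, ← Nat.cast_pow, Ne, ZMod.natCast_eq_zero_iff,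
      Nat.pow_dvd_pow_iff_le_right (Fact.out : p.Prime).one_lt]
    omega
  have hmm : m + 1 ≤ 2 * m := by omega
  have huK : upperUnipotent (P ^ (2 * m) * 1) ∈ Kset p (2 * m + 1) (m + 1) :=
    upperUnipotent_mem_Kset 1 hmm
  have hc : φ (upperUnipotent (P ^ (2 * m) * 1)) ≠ 1 := by
    rw [hφK _ huK, phiA, aChar_eq_stdAddChar]
    intro h
    refine hPne (ZMod.injective_stdAddChar ?_)
    rw [AddChar.map_zero_eq_one, ← h]
    congr 1
    simp [upperUnipotent, mul_sub, Matrix.trace_fin_two]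
  have hdet : (upperUnipotent (P ^ (2 * m) * 1)).val.det = 1 := by
    simp [upperUnipotent, Matrix.det_fin_two_of]
  have htr : ∀ X : GL (Fin 2) (ZMod (p ^ (2 * m + 1))),
      aChar (p ^ (2 * m + 1)) r (X * upperUnipotent (P ^ (2 * m) * 1)).val.trace =
        aChar (p ^ (2 * m + 1)) r X.val.trace := by
    intro X
    obtain ⟨s, rfl⟩ := hpr
    have h : (X * upperUnipotent (P ^ (2 * m) * 1)).val.trace =
        X.val.trace + P ^ (2 * m) * X.val 1 0 := by
      simp [upperUnipotent, Matrix.trace_fin_two, Matrix.mul_apply, Fin.sum_univ_two]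
      ring
    rw [aChar_eq_stdAddChar, aChar_eq_stdAddChar, h]
    congr 1
    push_cast
    linear_combination (s : ZMod (p ^ (2 * m + 1))) * X.val 1 0 * hPl
  have hφu : ∀ X ∈ TKS p (2 * m + 1) ε (m + 1),
      φ (X * upperUnipotent (P ^ (2 * m) * 1)) = φ X * φ (upperUnipotent (P ^ (2 * m) * 1)) :=
    fun X hX => hφmul X _ hX (Kset_subset_TKS ε huK)
  have hN := sum_det_mul_indC_mul_aChar_eq_zero r μ (NsetOdd p (2 * m + 1) ε m) φ _ hdet hc
    (mul_upperUnipotent_mem_iff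
      (fun t X hX => NsetOdd_mul_upperUnipotent_mem ε m hmm t hX) 1)
    (fun X hX => hφu X (NsetOdd_subset_TKS ε m hX)) htr
  have hT := sum_det_mul_indC_mul_aChar_eq_zero r μ (TKS p (2 * m + 1) ε (m + 1)) φ _ hdet hc
    (mul_upperUnipotent_mem_iff
      (fun t X hX => TKS_mul_mem hX (upperUnipotent_mem_Kset t hmm)) 1) hφu htr
  calc _ = (1 / (p : ℂ)) * ∑ X : GL (Fin 2) (ZMod (p ^ (2 * m + 1))), μ X.val.det *
          indC _ (NsetOdd p (2 * m + 1) ε m) Set.univ φ X * aChar _ r X.val.trace -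
        ∑ X : GL (Fin 2) (ZMod (p ^ (2 * m + 1))), μ X.val.det *
          indC _ (TKS p (2 * m + 1) ε (m + 1)) Set.univ φ X * aChar _ r X.val.trace := by
        rw [tauGL, Finset.mul_sum, ← Finset.sum_sub_distrib]
        exact Finset.sum_congr rfl fun X _ => by ring
    _ = 0 := by rw [hN, hT, mul_zero, sub_zero]
end
end

section
/- If p | r or p | α, then τ_l(χ) = 0, where χ = (μ∘det)·Ind_{T₀}^{G_l} ψ. (Theorem 3.6(1): vanishing of Gauss sums for the degree-p^{l−2}(p²−1) characters of G_l when p divides r or p divides α.) -/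
noncomputable section
open Matrix Complex

/-- `T₀ = {[[a, pβb+p^n c],[b, a+p^m d]]} ∩ GL₂(ℤ/p^l)`. -/
def T0beta (p l β m n : ℕ) : Set (GL (Fin 2) (ZMod (p ^ l))) :=
  {X | ∃ a b c d : ZMod (p ^ l),
    X.val = !![a, (p : ZMod (p ^ l)) * (β : ZMod (p ^ l)) * b + (p : ZMod (p ^ l)) ^ n * c;
               b, a + (p : ZMod (p ^ l)) ^ m * d]}

/-- `N = {[[1+p^m a, p^n b],[p^m c, 1+p^m d]]}` inside `GL₂(ℤ/p^l)`. -/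
def NsetX3 (p l m n : ℕ) : Set (GL (Fin 2) (ZMod (p ^ l))) :=
  {X | ∃ a b c d : ZMod (p ^ l),
    X.val = !![1 + (p : ZMod (p ^ l)) ^ m * a, (p : ZMod (p ^ l)) ^ n * b;
               (p : ZMod (p ^ l)) ^ m * c, 1 + (p : ZMod (p ^ l)) ^ m * d]}

/-- `S = {[[a, pβb],[b, a]]} ∩ GL₂(ℤ/p^l)`. -/
def SsetB (p l β : ℕ) : Set (GL (Fin 2) (ZMod (p ^ l))) :=
  {X | ∃ a b : ZMod (p ^ l),
    X.val = !![a, (p : ZMod (p ^ l)) * (β : ZMod (p ^ l)) * b; b, a]}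

/-- A sum over a finite group vanishes if right translation by `U` multiplies each term by a
`U`-invariant factor that differs from `1` on the support. -/
theorem sum_eq_zero_of_mul_right {G : Type*} [Group G] [Fintype G] (f ω : G → ℂ) (U : G)
    (hf : ∀ Y, f (Y * U) = f Y * ω Y) (hω : ∀ Y, ω (Y * U) = ω Y)
    (hne : ∀ Y, f Y ≠ 0 → ω Y ≠ 1) : ∑ Y, f Y = 0 := by
  have key : ∀ Y, f Y = f (Y * U) / (ω (Y * U) - 1) - f Y / (ω Y - 1) := by
    intro Y
    rw [hω, hf]
    by_cases h0 : f Y = 0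
    · simp [h0]
    · have h1 : ω Y - 1 ≠ 0 := sub_ne_zero.mpr (hne Y h0)
      field_simp
  rw [Finset.sum_congr rfl fun Y _ => key Y, Finset.sum_sub_distrib, sub_eq_zero]
  exact Equiv.sum_comp (Equiv.mulRight U) fun Y => f Y / (ω Y - 1)

/-- The Gauss sum of a twisted induced function vanishes once the corresponding sum over the
inducing set does. -/
theorem tauGL_mul_indC_eq_zero (N : ℕ) [NeZero N] (r : ℤ) (H : Set (GL (Fin 2) (ZMod N)))
    (μ : ZMod N → ℂ) (ψ : GL (Fin 2) (ZMod N) → ℂ)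
    (h : ∑ Y : GL (Fin 2) (ZMod N),
      H.indicator ψ Y * (μ Y.val.det * aChar N r (Matrix.trace Y.val)) = 0) :
    tauGL N r (fun X => μ X.val.det * indC N H Set.univ ψ X) = 0 := by
  simp only [tauGL, indC, Set.indicator_univ]
  have e : ∀ X : GL (Fin 2) (ZMod N),
      μ X.val.det * ((Nat.card H : ℂ)⁻¹ *
        ∑ x : GL (Fin 2) (ZMod N), H.indicator ψ (x * X * x⁻¹)) *
        aChar N r (Matrix.trace X.val) =
      (Nat.card H : ℂ)⁻¹ * ∑ x : GL (Fin 2) (ZMod N),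
        H.indicator ψ (x * X * x⁻¹) * (μ X.val.det * aChar N r (Matrix.trace X.val)) := by
    intro X
    rw [← Finset.sum_mul]
    ring
  rw [Finset.sum_congr rfl fun X _ => e X, ← Finset.mul_sum, Finset.sum_comm]
  refine mul_eq_zero_of_right _ (Finset.sum_eq_zero fun x _ => ?_)
  refine Eq.trans ?_ ((Equiv.sum_comp (MulAut.conj x).toEquiv _).trans h)
  refine Finset.sum_congr rfl fun X _ => ?_
  have hc : (MulAut.conj x).toEquiv X = x * X * x⁻¹ := rfl
  have hd : (x * X * x⁻¹).val.det = X.val.det := Matrix.det_units_conj x X.val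
  have ht : Matrix.trace (x * X * x⁻¹).val = Matrix.trace X.val := Matrix.trace_units_conj x X.val
  rw [hc, hd, ht]

theorem mul_mem_T0beta_of_val_eq_upper {p l β m n : ℕ} (hmn : m ≤ n)
    {Y U : GL (Fin 2) (ZMod (p ^ l))} (s : ZMod (p ^ l))
    (hU : U.val = !![1, (p : ZMod (p ^ l)) ^ n * s; 0, 1]) (hY : Y ∈ T0beta p l β m n) :
    Y * U ∈ T0beta p l β m n := by
  obtain ⟨k, rfl⟩ := Nat.exists_eq_add_of_le hmn
  obtain ⟨a, b, c, d, h⟩ := hY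
  refine ⟨a, b, c + a * s, d + (p : ZMod (p ^ l)) ^ k * b * s, ?_⟩
  rw [Units.val_mul, h, hU, Matrix.mul_fin_two]
  congr! 3 <;> ring_nf

theorem mul_mem_T0beta_of_val_eq_diag {p l β m n : ℕ} (hmn : m ≤ n)
    {Y U : GL (Fin 2) (ZMod (p ^ l))} (s : ZMod (p ^ l))
    (hU : U.val = !![1 + (p : ZMod (p ^ l)) ^ n * s, 0; 0, 1]) (hY : Y ∈ T0beta p l β m n) :
    Y * U ∈ T0beta p l β m n := by
  obtain ⟨k, rfl⟩ := Nat.exists_eq_add_of_le hmn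
  obtain ⟨a, b, c, d, h⟩ := hY
  refine ⟨a * (1 + (p : ZMod (p ^ l)) ^ (m + k) * s), b * (1 + (p : ZMod (p ^ l)) ^ (m + k) * s),
    c - p * β * b * s, d - (p : ZMod (p ^ l)) ^ k * a * s, ?_⟩
  rw [Units.val_mul, h, hU, Matrix.mul_fin_two]
  congr! 3 <;> ring_nf

theorem isUnit_apply_zero_zero_of_mem_T0beta {p l β m n : ℕ} (hn : n ≠ 0)
    {Y : GL (Fin 2) (ZMod (p ^ l))} (hY : Y ∈ T0beta p l β m n) : IsUnit (Y.val 0 0) := by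
  obtain ⟨a, b, c, d, h⟩ := hY
  obtain ⟨k, rfl⟩ := Nat.exists_eq_succ_of_ne_zero hn
  have hnil : IsNilpotent (p : ZMod (p ^ l)) := ⟨l, by exact_mod_cast ZMod.natCast_self (p ^ l)⟩
  have hdet : IsUnit Y.val.det := (Matrix.isUnit_iff_isUnit_det _).mp Y.isUnit
  have hu : IsUnit (a * (a + (p : ZMod (p ^ l)) ^ m * d)) := by
    have e : a * (a + (p : ZMod (p ^ l)) ^ m * d) =
        (p : ZMod (p ^ l)) * ((β * b + (p : ZMod (p ^ l)) ^ k * c) * b) + Y.val.det := by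
      rw [h, Matrix.det_fin_two_of, Nat.succ_eq_add_one, pow_succ]
      ring
    rw [e]
    exact (Commute.isNilpotent_mul_right (Commute.all _ _) hnil).isUnit_add_right_of_commute hdet
      (Commute.all _ _)
  rw [h]
  exact isUnit_of_mul_isUnit_left hu

theorem stdAddChar_pow_mul_ne_one {p l n : ℕ} [Fact p.Prime] (hn : n < l) {u : ZMod (p ^ l)}
    (hu : IsUnit u) : ZMod.stdAddChar ((p : ZMod (p ^ l)) ^ n * u) ≠ 1 := by
  intro h
  rw [← AddChar.map_zero_eq_one (ZMod.stdAddChar (N := p ^ l))] at h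
  have h0 := hu.mul_left_eq_zero.mp (ZMod.injective_stdAddChar h)
  have h1 : ((p ^ n : ℕ) : ZMod (p ^ l)) = 0 := by exact_mod_cast h0
  rw [ZMod.natCast_eq_zero_iff] at h1
  exact absurd ((Nat.pow_dvd_pow_iff_le_right (Fact.out : p.Prime).one_lt).mp h1) (by omega)

/-- Theorem 3.6(1): for `χ = (μ∘det)·Ind_{T₀}^{G_l} ψ` of degree `p^{l-2}(p²-1)`,
if `p ∣ r` or `p ∣ α` then `τ_l(χ) = 0`. -/
theorem gauss_sum_X3_vanishing (p l m n : ℕ) [Fact p.Prime] (hp : Odd p) (hl : 2 ≤ l)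
    (hm : m = l / 2) (hn : n = l - l / 2)
    (r : ℤ) (hr : ¬ ((p : ℤ) ^ l ∣ r))
    (α β : ℕ) (hα : α < p ^ m) (hβ : β < p ^ (m - 1))
    (hdiv : (p : ℤ) ∣ r ∨ p ∣ α)
    (i₁ i₂ : ℕ) (hi₁ : i₁ < p ^ (n - m)) (hi₂ : i₂ < p ^ (n - m))
    (μ : ZMod (p ^ l) → ℂ)
    (hμmul : ∀ x y : ZMod (p ^ l), IsUnit x → IsUnit y → μ (x * y) = μ x * μ y)
    (hμne : ∀ x : ZMod (p ^ l), IsUnit x → μ x ≠ 0)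
    (hμ : μ (1 + (p : ZMod (p ^ l)) ^ n) =
      aChar (p ^ l) 1 ((p : ZMod (p ^ l)) ^ n * (α : ZMod (p ^ l))))
    (ψ : GL (Fin 2) (ZMod (p ^ l)) → ℂ)
    (hψmul : ∀ X Y : GL (Fin 2) (ZMod (p ^ l)),
      X ∈ T0beta p l β m n → Y ∈ T0beta p l β m n → ψ (X * Y) = ψ X * ψ Y)
    (hψne : ∀ X ∈ T0beta p l β m n, ψ X ≠ 0)
    (hψN : ∀ (a b c d : ZMod (p ^ l)) (X : GL (Fin 2) (ZMod (p ^ l))),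
      X.val = !![1 + (p : ZMod (p ^ l)) ^ m * a, (p : ZMod (p ^ l)) ^ n * b;
                 (p : ZMod (p ^ l)) ^ m * c, 1 + (p : ZMod (p ^ l)) ^ m * d] →
      ψ X = aChar (p ^ l) 1 ((p : ZMod (p ^ l)) ^ (2 * m) * ((i₁ : ZMod (p ^ l)) * a + (i₂ : ZMod (p ^ l)) * d)) *
        aChar (p ^ l) 1 ((p : ZMod (p ^ l)) ^ (m + 1) * (β : ZMod (p ^ l)) * c +
          (p : ZMod (p ^ l)) ^ n * b)) :
    tauGL (p ^ l) r
      (fun X => μ X.val.det * indC (p ^ l) (T0beta p l β m n) Set.univ ψ X) = 0 := by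
  have hmn : m ≤ n := by omega
  have hnl : n < l := by omega
  have hn0 : n ≠ 0 := by omega
  have hp0 : (p : ZMod (p ^ l)) ^ l = 0 := by exact_mod_cast ZMod.natCast_self (p ^ l)
  have hnil : IsNilpotent (p : ZMod (p ^ l)) := ⟨l, hp0⟩
  have hpn2 : (p : ZMod (p ^ l)) ^ n * (p : ZMod (p ^ l)) ^ n = 0 := by
    rw [← pow_add]
    exact pow_eq_zero_of_le (by omega) hp0
  have hμ1 : μ 1 = 1 := by
    have h := hμmul 1 1 isUnit_one isUnit_one
    rw [mul_one] at h
    exact (mul_eq_left₀ (hμne 1 isUnit_one)).mp h.symm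
  apply tauGL_mul_indC_eq_zero
  simp only [aChar_eq_stdAddChar, Int.cast_one, one_mul] at hμ hψN ⊢
  -- right translation by `U` transforms the summand through `ψ U`, `μ (det U)` and the trace
  have translate : ∀ (U : GL (Fin 2) (ZMod (p ^ l))) (κ : ZMod (p ^ l))
      (t : GL (Fin 2) (ZMod (p ^ l)) → ZMod (p ^ l)),
      U ∈ T0beta p l β m n →
      (∀ Y, Y ∈ T0beta p l β m n ↔ Y * U ∈ T0beta p l β m n) →
      ψ U * μ U.val.det = ZMod.stdAddChar ((p : ZMod (p ^ l)) ^ n * κ) →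
      (∀ Y, (Y * U).val.trace = Y.val.trace + (p : ZMod (p ^ l)) ^ n * t Y) →
      (∀ Y, (p : ZMod (p ^ l)) ^ n * t (Y * U) = (p : ZMod (p ^ l)) ^ n * t Y) →
      (∀ Y ∈ T0beta p l β m n, IsUnit (κ + (r : ZMod (p ^ l)) * t Y)) →
      ∑ Y : GL (Fin 2) (ZMod (p ^ l)), (T0beta p l β m n).indicator ψ Y *
        (μ Y.val.det * ZMod.stdAddChar ((r : ZMod (p ^ l)) * Y.val.trace)) = 0 := by
    intro U κ t hUT hiff hψU htr ht hunit
    refine sum_eq_zero_of_mul_right _ (fun Y => ZMod.stdAddChar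
      ((p : ZMod (p ^ l)) ^ n * (κ + (r : ZMod (p ^ l)) * t Y))) U ?_ ?_ ?_
    · intro Y
      by_cases hY : Y ∈ T0beta p l β m n
      · have hdet : ∀ Z : GL (Fin 2) (ZMod (p ^ l)), IsUnit Z.val.det := fun Z =>
          (Matrix.isUnit_iff_isUnit_det _).mp Z.isUnit
        have hmul : (Y * U).val.det = Y.val.det * U.val.det := by
          rw [Units.val_mul, Matrix.det_mul]
        have e : (r : ZMod (p ^ l)) * (Y.val.trace + (p : ZMod (p ^ l)) ^ n * t Y) =
            r * Y.val.trace + (p : ZMod (p ^ l)) ^ n * (r * t Y) := by ring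
        rw [Set.indicator_of_mem hY, Set.indicator_of_mem ((hiff Y).mp hY), hψmul Y U hY hUT,
          hmul, hμmul _ _ (hdet Y) (hdet U), htr, e, mul_add, AddChar.map_add_eq_mul,
          AddChar.map_add_eq_mul, ← hψU]
        ring
      · rw [Set.indicator_of_notMem hY, Set.indicator_of_notMem (fun h => hY ((hiff Y).mpr h))]
        simp
    · intro Y
      simp only [mul_add, mul_left_comm _ (r : ZMod (p ^ l)), ht]
    · intro Y hY
      have hmem : Y ∈ T0beta p l β m n := by
        by_contra h
        rw [Set.indicator_of_notMem h, zero_mul] at hY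
        exact hY rfl
      exact stdAddChar_pow_mul_ne_one hnl (hunit Y hmem)
  have one_mem : (1 : GL (Fin 2) (ZMod (p ^ l))) ∈ T0beta p l β m n :=
    ⟨1, 0, 0, 0, by rw [Units.val_one, Matrix.one_fin_two]; simp⟩
  by_cases hpr : (p : ℤ) ∣ r
  · let U : GL (Fin 2) (ZMod (p ^ l)) :=
      ⟨!![1, (p : ZMod (p ^ l)) ^ n * 1; 0, 1], !![1, (p : ZMod (p ^ l)) ^ n * (-1); 0, 1],
        by rw [Matrix.mul_fin_two, Matrix.one_fin_two]; simp,
        by rw [Matrix.mul_fin_two, Matrix.one_fin_two]; simp⟩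
    have hU : U.val = !![1, (p : ZMod (p ^ l)) ^ n * 1; 0, 1] := rfl
    have hmem : ∀ Y ∈ T0beta p l β m n, Y * U ∈ T0beta p l β m n := fun Y hY =>
      mul_mem_T0beta_of_val_eq_upper hmn 1 rfl hY
    refine translate U 1 (fun Y => Y.val 1 0) (by simpa using hmem 1 one_mem)
      (fun Y => ⟨hmem Y, fun h => ?_⟩) ?_ ?_ ?_ ?_
    · simpa using mul_mem_T0beta_of_val_eq_upper (U := U⁻¹) hmn (-1) rfl h
    · rw [hψN 0 1 0 0 U (by rw [hU]; simp), hU]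
      simp [hμ1]
    · intro Y
      rw [Units.val_mul, hU, Matrix.trace_fin_two, Matrix.trace_fin_two]
      simp [Matrix.mul_apply, Fin.sum_univ_two]
      ring
    · intro Y
      rw [Units.val_mul, hU]
      simp [Matrix.mul_apply, Fin.sum_univ_two]
    · intro Y _
      obtain ⟨k, rfl⟩ := hpr
      push_cast
      rw [mul_assoc]
      exact (Commute.isNilpotent_mul_right (Commute.all _ _) hnil).isUnit_one_add
  · obtain ⟨k, rfl⟩ := hdiv.resolve_left hpr
    have hr' : IsUnit (r : ZMod (p ^ l)) := by
      rw [ZMod.coe_int_isUnit_iff_isCoprime]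
      push_cast
      exact (((Nat.prime_iff_prime_int.mp Fact.out).coprime_iff_not_dvd).mpr hpr).pow_left
    have hinv : (1 + (p : ZMod (p ^ l)) ^ n * 1) * (1 + (p : ZMod (p ^ l)) ^ n * (-1)) = 1 := by
      linear_combination -hpn2
    let U : GL (Fin 2) (ZMod (p ^ l)) :=
      ⟨!![1 + (p : ZMod (p ^ l)) ^ n * 1, 0; 0, 1], !![1 + (p : ZMod (p ^ l)) ^ n * (-1), 0; 0, 1],
        by rw [Matrix.mul_fin_two, Matrix.one_fin_two, hinv]; simp,
        by rw [Matrix.mul_fin_two, Matrix.one_fin_two, mul_comm (1 + _ * (-1)), hinv]; simp⟩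
    have hU : U.val = !![1 + (p : ZMod (p ^ l)) ^ n * 1, 0; 0, 1] := rfl
    have hmem : ∀ Y ∈ T0beta p l β m n, Y * U ∈ T0beta p l β m n := fun Y hY =>
      mul_mem_T0beta_of_val_eq_diag hmn 1 rfl hY
    refine translate U ((p * k : ℕ) : ZMod (p ^ l)) (fun Y => Y.val 0 0)
      (by simpa using hmem 1 one_mem) (fun Y => ⟨hmem Y, fun h => ?_⟩) ?_ ?_ ?_ ?_
    · simpa using mul_mem_T0beta_of_val_eq_diag (U := U⁻¹) hmn (-1) rfl h
    · have hm' : (p : ZMod (p ^ l)) ^ m * (p : ZMod (p ^ l)) ^ (n - m) =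
          (p : ZMod (p ^ l)) ^ n := by
        rw [← pow_add]
        congr 1
        omega
      have h2m : (p : ZMod (p ^ l)) ^ (2 * m) * (i₁ * (p : ZMod (p ^ l)) ^ (n - m)) = 0 := by
        rw [mul_left_comm, ← pow_add, pow_eq_zero_of_le (by omega) hp0, mul_zero]
      rw [hψN ((p : ZMod (p ^ l)) ^ (n - m)) 0 0 0 U (by rw [hU, hm']; simp), hU, ← hμ]
      simp [h2m]
    · intro Y
      rw [Units.val_mul, hU, Matrix.trace_fin_two, Matrix.trace_fin_two]
      simp [Matrix.mul_apply, Fin.sum_univ_two]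
      ring
    · intro Y
      rw [Units.val_mul, hU]
      simp [Matrix.mul_apply, Fin.sum_univ_two]
      linear_combination Y.val 0 0 * hpn2
    · intro Y hY
      push_cast
      exact (Commute.isNilpotent_mul_right (Commute.all _ _) hnil).isUnit_add_right_of_commute
        (hr'.mul (isUnit_apply_zero_zero_of_mem_T0beta hn0 hY)) (Commute.all _ _)
end
end

section
/- If p ∤ r, then τ_l(θ∘π) = 0 for every function θ : G_{l−1} → ℂ (in particular for every irreducible character θ of G_{l−1}). (Vanishing claim of §3.5 for characters pulled back from G_{l−1}.) -/
noncomputable section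
open Matrix Complex

/-- The reduction homomorphism `π : GL₂(ℤ/p^l) → GL₂(ℤ/p^{l-1})`. -/
def piGL (p l : ℕ) : GL (Fin 2) (ZMod (p ^ l)) →* GL (Fin 2) (ZMod (p ^ (l - 1))) :=
  Units.map
    ((ZMod.castHom (pow_dvd_pow p (Nat.sub_le l 1)) (ZMod (p ^ (l - 1)))).mapMatrix).toMonoidHom

theorem aChar_add (N : ℕ) [NeZero N] (r : ℤ) (x y : ZMod N) :
    aChar N r (x + y) = aChar N r x * aChar N r y := by
  simp only [aChar_eq_stdAddChar, mul_add, AddChar.map_add_eq_mul]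

theorem aChar_eq_one_iff (N : ℕ) [NeZero N] (r : ℤ) (x : ZMod N) :
    aChar N r x = 1 ↔ (r : ZMod N) * x = 0 := by
  rw [aChar_eq_stdAddChar, ← AddChar.map_zero_eq_one (ZMod.stdAddChar (N := N)),
    ZMod.injective_stdAddChar.eq_iff]

theorem isUnit_add_single_of_isNilpotent {R : Type*} [CommRing R] {c : R} (hc : IsNilpotent c)
    (X : GL (Fin 2) R) : IsUnit (X.val + Matrix.single 0 0 c) := by
  rw [Matrix.isUnit_iff_isUnit_det]
  have h : (X.val + Matrix.single 0 0 c).det = X.val.det + c * X.val 1 1 := by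
    simp [Matrix.det_fin_two]
    ring
  rw [h]
  have hn : IsNilpotent (c * X.val 1 1) := (Commute.all _ _).isNilpotent_mul_right hc
  exact hn.isUnit_add_left_of_commute ((Matrix.isUnit_iff_isUnit_det _).1 X.isUnit)
    (Commute.all _ _)

/-- Translation of `GL₂(R)` by a nilpotent multiple of the matrix unit `E₁₁`. -/
def addSingleGL {R : Type*} [CommRing R] {c : R} (hc : IsNilpotent c) (X : GL (Fin 2) R) :
    GL (Fin 2) R :=
  (isUnit_add_single_of_isNilpotent hc X).unit

theorem val_addSingleGL {R : Type*} [CommRing R] {c : R} (hc : IsNilpotent c)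
    (X : GL (Fin 2) R) : (addSingleGL hc X).val = X.val + Matrix.single 0 0 c :=
  rfl

theorem addSingleGL_injective {R : Type*} [CommRing R] {c : R} (hc : IsNilpotent c) :
    Function.Injective (addSingleGL hc) := fun X Y h => by
  have h' := congrArg Units.val h
  rw [val_addSingleGL, val_addSingleGL] at h'
  exact Units.ext (add_right_cancel h')

/-- A Gauss sum vanishes when `χ` is invariant under a nilpotent translation along `E₁₁` on which
the additive character is nontrivial. -/
theorem tauGL_eq_zero_of_addSingleGL {N : ℕ} [NeZero N] {r : ℤ} {χ : GL (Fin 2) (ZMod N) → ℂ}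
    {c : ZMod N} (hc : IsNilpotent c) (hχ : ∀ X, χ (addSingleGL hc X) = χ X)
    (hrc : (r : ZMod N) * c ≠ 0) : tauGL N r χ = 0 := by
  have h : tauGL N r χ = tauGL N r χ * aChar N r c := by
    conv_lhs => rw [tauGL, ← (Finite.injective_iff_bijective.1
      (addSingleGL_injective hc)).sum_comp]
    rw [tauGL, Finset.sum_mul]
    refine Finset.sum_congr rfl fun X _ => ?_
    rw [hχ, val_addSingleGL, Matrix.trace_add, Matrix.trace_single_eq_same, aChar_add, mul_assoc]
  by_contra h0
  exact hrc ((aChar_eq_one_iff N r c).1 (mul_left_cancel₀ h0 (by rw [← h, mul_one])))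

theorem piGL_addSingleGL {p l : ℕ} {c : ZMod (p ^ l)} (hc : IsNilpotent c)
    (h : ZMod.castHom (pow_dvd_pow p (Nat.sub_le l 1)) (ZMod (p ^ (l - 1))) c = 0)
    (X : GL (Fin 2) (ZMod (p ^ l))) : piGL p l (addSingleGL hc X) = piGL p l X := by
  apply Units.ext
  change RingHom.mapMatrix _ (addSingleGL hc X).val = RingHom.mapMatrix _ X.val
  rw [val_addSingleGL, map_add, add_eq_left, RingHom.mapMatrix_apply, Matrix.map_single _ _ _ _, h,
    Matrix.single_zero]

/-- §3.5: if `p ∤ r`, then `τ_l(θ∘π) = 0` for every function `θ` on `GL₂(ℤ/p^{l-1})`,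
in particular for every irreducible character of `GL₂(ℤ/p^{l-1})`. -/
theorem gauss_sum_X4_pullback_vanishing (p l : ℕ) [Fact p.Prime] (hp : Odd p) (hl : 2 ≤ l)
    (r : ℤ) (hr : ¬ ((p : ℤ) ^ l ∣ r)) (hpr : ¬ ((p : ℤ) ∣ r))
    (θ : GL (Fin 2) (ZMod (p ^ (l - 1))) → ℂ) :
    tauGL (p ^ l) r (fun X => θ (piGL p l X)) = 0 := by
  have hp0 : (p : ℤ) ≠ 0 := by exact_mod_cast (Fact.out : p.Prime).ne_zero
  have hc : IsNilpotent ((p : ZMod (p ^ l)) ^ (l - 1)) :=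
    IsNilpotent.pow_of_pos ⟨l, by exact_mod_cast ZMod.natCast_self (p ^ l)⟩ (by omega)
  refine tauGL_eq_zero_of_addSingleGL hc
    (fun X => congrArg θ (piGL_addSingleGL hc ?_ X)) fun h => hpr ?_
  · rw [map_pow, map_natCast]
    exact_mod_cast ZMod.natCast_self (p ^ (l - 1))
  · have h' : ((r * (p : ℤ) ^ (l - 1) : ℤ) : ZMod (p ^ l)) = 0 := by exact_mod_cast h
    rw [ZMod.intCast_zmod_eq_zero_iff_dvd] at h'
    push_cast at h'
    obtain ⟨k, rfl⟩ : ∃ k, l = k + 1 := ⟨l - 1, by omega⟩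
    rw [Nat.add_sub_cancel, pow_succ'] at h'
    exact (mul_dvd_mul_iff_right (pow_ne_zero k hp0)).1 h'
end
end

section
/- If p | r (and p^l ∤ r), then for every integer i with 1 ≤ i < p and every function θ : G_{l−1} → ℂ, τ_l(ν^i·(θ∘π)) = 0, where ν^i·(θ∘π) denotes the function X ↦ ν₀(det X)^i·θ(π(X)). (Vanishing claim of §3.5.) -/
noncomputable section
open Matrix Complex

/-- The character `aChar N r` takes equal values at residues `a`, `b` with `N ∣ r * (a - b)`. -/
theorem aChar_eq_of_dvd {N : ℕ} [NeZero N] {r : ℤ} {a b : ZMod N}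
    (h : (N : ℤ) ∣ r * ((a.val : ℤ) - b.val)) : aChar N r a = aChar N r b := by
  obtain ⟨k, hk⟩ := h
  have hN : (N : ℂ) ≠ 0 := Nat.cast_ne_zero.mpr (NeZero.ne N)
  have hk' : (r : ℂ) * ((a.val : ℂ) - b.val) = N * k := by exact_mod_cast hk
  unfold aChar
  rw [Complex.exp_eq_exp_iff_exists_int]
  refine ⟨k, ?_⟩
  field_simp
  linear_combination hk'

/-- If `p ∣ r`, then `aChar (p ^ l) r` is invariant under translation by `p ^ (l - 1)`-multiples. -/
theorem aChar_add_pow_mul {p l : ℕ} [Fact p.Prime] (hl : l ≠ 0) {r : ℤ} (hpr : (p : ℤ) ∣ r)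
    (x y : ZMod (p ^ l)) :
    aChar (p ^ l) r (x + (p : ZMod (p ^ l)) ^ (l - 1) * y) = aChar (p ^ l) r x := by
  apply aChar_eq_of_dvd
  have hmod : ((p ^ l : ℕ) : ℤ) ∣
      ((x + (p : ZMod (p ^ l)) ^ (l - 1) * y).val : ℤ) - x.val - (p : ℤ) ^ (l - 1) * y.val := by
    rw [← ZMod.intCast_zmod_eq_zero_iff_dvd]
    push_cast
    simp only [ZMod.natCast_val, ZMod.cast_id', id_eq]
    ring
  have hpow : ((p ^ l : ℕ) : ℤ) = p * (p : ℤ) ^ (l - 1) := by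
    push_cast
    exact (mul_pow_sub_one hl _).symm
  rw [hpow] at hmod ⊢
  refine mul_dvd_mul hpr ?_
  have := (dvd_trans (dvd_mul_left _ _) hmod).add (dvd_mul_right ((p : ℤ) ^ (l - 1)) (y.val : ℤ))
  simpa using this

/-- A Gauss sum over `GL₂` vanishes if translation by some `g` preserves the values of the
additive character and multiplies `χ` by a constant `c ≠ 1`. -/
theorem tauGL_eq_zero_of_translate {N : ℕ} [NeZero N] {r : ℤ} {χ : GL (Fin 2) (ZMod N) → ℂ}
    (g : GL (Fin 2) (ZMod N)) {c : ℂ} (hc : c ≠ 1) (hχ : ∀ X, χ (X * g) = c * χ X)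
    (htr : ∀ X : GL (Fin 2) (ZMod N),
      aChar N r (Matrix.trace (X * g).val) = aChar N r (Matrix.trace X.val)) :
    tauGL N r χ = 0 := by
  have h : tauGL N r χ = c * tauGL N r χ := by
    unfold tauGL
    rw [Finset.mul_sum, ← Equiv.sum_comp (Equiv.mulRight g)]
    refine Finset.sum_congr rfl fun X _ => ?_
    rw [Equiv.coe_mulRight, hχ, htr, mul_assoc]
  have h' : (c - 1) * tauGL N r χ = 0 := by linear_combination -h
  exact (mul_eq_zero.mp h').resolve_left (sub_ne_zero.mpr hc)

/-- §3.5: if `p ∣ r` (and `p^l ∤ r`), then `τ_l(ν^i·(θ∘π)) = 0` for every `1 ≤ i < p`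
and every function `θ` on `GL₂(ℤ/p^{l-1})`, where `ν = ν₀∘det`. -/
theorem gauss_sum_X4_twisted_vanishing (p l : ℕ) [Fact p.Prime] (hp : Odd p) (hl : 2 ≤ l)
    (r : ℤ) (hr : ¬ ((p : ℤ) ^ l ∣ r)) (hpr : (p : ℤ) ∣ r)
    (ν₀ : ZMod (p ^ l) → ℂ)
    (hνmul : ∀ x y : ZMod (p ^ l), IsUnit x → IsUnit y → ν₀ (x * y) = ν₀ x * ν₀ y)
    (hνne : ∀ x : ZMod (p ^ l), IsUnit x → ν₀ x ≠ 0)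
    (hν : ν₀ (1 + (p : ZMod (p ^ l)) ^ (l - 1)) =
      Complex.exp (2 * Real.pi * Complex.I / (p : ℂ)))
    (i : ℕ) (hi1 : 1 ≤ i) (hip : i < p)
    (θ : GL (Fin 2) (ZMod (p ^ (l - 1))) → ℂ) :
    tauGL (p ^ l) r (fun X => ν₀ X.val.det ^ i * θ (piGL p l X)) = 0 := by
  have hl0 : l ≠ 0 := by omega
  set q : ZMod (p ^ l) := (p : ZMod (p ^ l)) ^ (l - 1) with hq
  have hqq : q * q = 0 := by
    rw [hq, ← pow_add]
    exact pow_eq_zero_of_le (show l ≤ l - 1 + (l - 1) by omega)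
      (by exact_mod_cast ZMod.natCast_self (p ^ l))
  have hu : IsUnit (1 + q) := IsUnit.of_mul_eq_one (1 - q) (by linear_combination -hqq)
  have hdet : (Matrix.diagonal ![1 + q, 1]).det = 1 + q := by simp
  let g : GL (Fin 2) (ZMod (p ^ l)) :=
    Matrix.GeneralLinearGroup.mk'' (Matrix.diagonal ![1 + q, 1]) (by rwa [hdet])
  have hgval : g.val = Matrix.diagonal ![1 + q, 1] := rfl
  have hπq : ZMod.castHom (pow_dvd_pow p (Nat.sub_le l 1)) (ZMod (p ^ (l - 1))) q = 0 := by
    rw [hq, map_pow, map_natCast]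
    exact_mod_cast ZMod.natCast_self (p ^ (l - 1))
  have hπ : piGL p l g = 1 := by
    ext a b
    change ZMod.castHom (pow_dvd_pow p (Nat.sub_le l 1)) (ZMod (p ^ (l - 1))) (g.val a b) =
      (1 : Matrix (Fin 2) (Fin 2) (ZMod (p ^ (l - 1)))) a b
    rw [hgval]
    fin_cases a <;> fin_cases b <;> simp [-ZMod.castHom_apply, hπq]
  have hζ : Complex.exp (2 * Real.pi * Complex.I / (p : ℂ)) ^ i ≠ 1 :=
    (Complex.isPrimitiveRoot_exp p (NeZero.ne p)).pow_ne_one_of_pos_of_lt (by omega) hip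
  refine tauGL_eq_zero_of_translate g hζ (fun X => ?_) (fun X => ?_)
  · have hX : IsUnit X.val.det := (Matrix.isUnit_iff_isUnit_det _).mp X.isUnit
    rw [map_mul, hπ, mul_one, Units.val_mul, Matrix.det_mul, hgval, hdet, hνmul _ _ hX hu, hν]
    ring
  · rw [← aChar_add_pow_mul hl0 hpr (Matrix.trace X.val) (X.val 0 0), ← hq, Units.val_mul, hgval]
    congr 1
    simp only [Matrix.trace_fin_two, Matrix.mul_diagonal, Matrix.cons_val_zero,
      Matrix.cons_val_one]
    ring
end
end

section
/- If p | r (and p^l ∤ r), then for every function θ : G_{l−1} → ℂ one has τ_l(θ∘π) = p⁴ · Σ_{Y∈G_{l−1}} θ(Y)·e′(Tr Y), where e′ : ℤ/p^{l−1}ℤ → ℂ is the additive character e′(y) = ζ_{p^{l−1}}^{(r/p)·y}. In other words, the Gauss sum on G_l of a character pulled back from G_{l−1} equals p⁴ times the corresponding Gauss sum on G_{l−1}. (§3.5 reduction formula.) -/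
noncomputable section
open Matrix Complex

theorem Fintype.sum_comp_addMonoidHom_of_surjective {A B R : Type*} [AddGroup A] [AddGroup B]
    [Fintype A] [Fintype B] [Semiring R] (φ : A →+ B) (hφ : Function.Surjective φ) {k : ℕ}
    (hk : Fintype.card A = k * Fintype.card B) (g : B → R) :
    ∑ a, g (φ a) = k * ∑ b, g b := by
  classical
  have hconst (b : B) : Finset.card {a | φ a = b} = Finset.card {a | φ a = 0} :=
    AddMonoidHom.card_fiber_eq_of_mem_range φ (hφ b) (hφ 0)
  have hcard : Fintype.card A = ∑ b : B, Finset.card {a | φ a = b} :=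
    Finset.card_eq_sum_card_fiberwise (fun _ _ => Finset.mem_coe.2 (Finset.mem_univ _))
  have hker : Finset.card {a | φ a = 0} = k := by
    simp only [hconst, Finset.sum_const, Finset.card_univ, smul_eq_mul] at hcard
    have hB : 0 < Fintype.card B := Fintype.card_pos
    exact Nat.eq_of_mul_eq_mul_right hB (by rw [← hk, hcard, mul_comm])
  calc ∑ a, g (φ a) = ∑ b, ∑ a with φ a = b, g (φ a) :=
        (Finset.sum_fiberwise _ _ _).symm
    _ = ∑ b, (k : R) * g b := by
        refine Finset.sum_congr rfl fun b _ => ?_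
        rw [Finset.sum_congr rfl (g := fun _ => g b) fun a ha => by
            rw [(Finset.mem_filter.1 ha).2],
          Finset.sum_const, hconst, hker, nsmul_eq_mul]
    _ = k * ∑ b, g b := (Finset.mul_sum _ _ _).symm

theorem ZMod.isUnit_of_isUnit_castHom_pow {p a b : ℕ} [Fact p.Prime] (hab : a ≤ b) (ha : a ≠ 0)
    {x : ZMod (p ^ b)} (hx : IsUnit (ZMod.castHom (pow_dvd_pow p hab) (ZMod (p ^ a)) x)) :
    IsUnit x := by
  have hp : NeZero p := ⟨(Fact.out : p.Prime).ne_zero⟩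
  rw [← ZMod.natCast_zmod_val x, map_natCast, ZMod.isUnit_iff_coprime] at hx
  rw [← ZMod.natCast_zmod_val x, ZMod.isUnit_iff_coprime]
  exact ((Nat.coprime_pow_right_iff (Nat.pos_of_ne_zero ha) _ _).1 hx).pow_right b

theorem aChar_mul_castHom {N d : ℕ} [NeZero N] [NeZero d] (s : ℤ) {M : ℕ} (hM : M = N * d)
    (h : N ∣ M) (x : ZMod M) :
    aChar N s (ZMod.castHom h (ZMod N) x) = aChar M (d * s) x := by
  subst hM
  have hN : (N : ℂ) ≠ 0 := NeZero.ne _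
  have hd : (d : ℂ) ≠ 0 := NeZero.ne _
  have hval : (ZMod.castHom h (ZMod N) x).val = x.val % N := by
    conv_lhs => rw [← ZMod.natCast_zmod_val x, map_natCast, ZMod.val_natCast]
  have hdiv : (x.val : ℂ) = ((x.val % N : ℕ) : ℂ) + N * ((x.val / N : ℕ) : ℂ) :=
    mod_cast (Nat.mod_add_div x.val N).symm
  rw [aChar, aChar, hval, eq_comm, Complex.exp_eq_exp_iff_exists_int]
  refine ⟨s * ((x.val / N : ℕ) : ℤ), ?_⟩
  rw [hdiv]
  generalize x.val / N = q
  push_cast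
  field_simp

theorem sum_units_eq_sum_dite {M R : Type*} [Monoid M] [Fintype M] [Fintype Mˣ]
    [DecidablePred (IsUnit : M → Prop)] [AddCommMonoid R] (f : Mˣ → R) :
    ∑ u, f u = ∑ m : M, if h : IsUnit m then f h.unit else 0 := by
  refine Fintype.sum_of_injective Units.val Units.val_injective _ _ (fun m hm => ?_) fun u => ?_
  · exact dif_neg hm
  · rw [dif_pos u.isUnit]
    congr 1
    exact Units.ext rfl

theorem sum_comp_piGL {p l : ℕ} [Fact p.Prime] (hl : 2 ≤ l)
    (f : GL (Fin 2) (ZMod (p ^ (l - 1))) → ℂ) :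
    ∑ X, f (piGL p l X) = (p : ℂ) ^ 4 * ∑ Y, f Y := by
  classical
  set c := ZMod.castHom (pow_dvd_pow p (Nat.sub_le l 1)) (ZMod (p ^ (l - 1)))
  have hunit (m : Matrix (Fin 2) (Fin 2) (ZMod (p ^ l))) :
      IsUnit (c.mapMatrix m) → IsUnit m := by
    intro h
    rw [Matrix.isUnit_iff_isUnit_det, ← RingHom.map_det] at h
    exact (Matrix.isUnit_iff_isUnit_det m).2
      (ZMod.isUnit_of_isUnit_castHom_pow (Nat.sub_le l 1) (by omega) h)
  have hsurj : Function.Surjective (c.mapMatrix (m := Fin 2)).toAddMonoidHom := by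
    intro m
    choose g hg using fun i j => ZMod.castHom_surjective (pow_dvd_pow p (Nat.sub_le l 1)) (m i j)
    exact ⟨Matrix.of g, Matrix.ext hg⟩
  have hcard : Fintype.card (Matrix (Fin 2) (Fin 2) (ZMod (p ^ l))) =
      p ^ 4 * Fintype.card (Matrix (Fin 2) (Fin 2) (ZMod (p ^ (l - 1)))) := by
    obtain ⟨k, rfl⟩ : ∃ k, l = k + 1 := ⟨l - 1, by omega⟩
    simp only [← Fintype.card_congr Matrix.of, Fintype.card_fun, ZMod.card, Fintype.card_fin,
      Nat.add_sub_cancel]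
    ring
  have hsum := Fintype.sum_comp_addMonoidHom_of_surjective c.mapMatrix.toAddMonoidHom hsurj hcard
    fun m : Matrix (Fin 2) (Fin 2) (ZMod (p ^ (l - 1))) => if h : IsUnit m then f h.unit else 0
  rw [sum_units_eq_sum_dite, sum_units_eq_sum_dite, ← Nat.cast_pow, ← hsum]
  refine Finset.sum_congr rfl fun m _ => ?_
  by_cases hm : IsUnit m
  · have hm' : IsUnit (c.mapMatrix m) := hm.map c.mapMatrix
    rw [dif_pos hm]
    refine Eq.trans ?_ (dif_pos hm').symm
    congr 1
    exact Units.ext rfl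
  · have hm' : ¬ IsUnit (c.mapMatrix m) := fun h => hm (hunit m h)
    rw [dif_neg hm, eq_comm]
    exact dif_neg hm'

/-- §3.5 reduction formula: if `p ∣ r` (and `p^l ∤ r`), then for every function `θ` on
`GL₂(ℤ/p^{l-1})` one has `τ_l(θ∘π) = p⁴ · Σ_{Y∈G_{l-1}} θ(Y)·e'(Tr Y)`, where
`e'(y) = ζ_{p^{l-1}}^{(r/p)·y}`: the Gauss sum of a pulled-back character is `p⁴`
times the corresponding Gauss sum on `GL₂(ℤ/p^{l-1})`. -/
theorem gauss_sum_X4_reduction (p l : ℕ) [Fact p.Prime] (hp : Odd p) (hl : 2 ≤ l)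
    (r : ℤ) (hr : ¬ ((p : ℤ) ^ l ∣ r)) (hpr : (p : ℤ) ∣ r)
    (θ : GL (Fin 2) (ZMod (p ^ (l - 1))) → ℂ) :
    tauGL (p ^ l) r (fun X => θ (piGL p l X)) =
      (p : ℂ) ^ 4 * tauGL (p ^ (l - 1)) (r / p) θ := by
  have : NeZero p := ⟨(Fact.out : p.Prime).ne_zero⟩
  obtain ⟨s, rfl⟩ := hpr
  have hp0 : (p : ℤ) ≠ 0 := NeZero.ne _
  rw [Int.mul_ediv_cancel_left s hp0, tauGL, tauGL, ← sum_comp_piGL hl]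
  refine Finset.sum_congr rfl fun X _ => ?_
  have hpow : p ^ l = p ^ (l - 1) * p := (pow_sub_one_mul (by omega) p).symm
  have htr : Matrix.trace (piGL p l X).val =
      ZMod.castHom (pow_dvd_pow p (Nat.sub_le l 1)) (ZMod (p ^ (l - 1))) (Matrix.trace X.val) :=
    (AddMonoidHom.map_trace _ _).symm
  rw [htr, aChar_mul_castHom s hpow]
end
end
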